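/- Let D = Σ_j D_{L_j} be a total dissipator on M_d(ℂ) and define R(D) := min over unit vectors u, v ∈ ℂ^d with ⟨u, v⟩ = 0 of Σ_j (|⟨v, L_j u⟩|² + |⟨v, L_j† u⟩|²). If R(D) > 0, then for every time-dependent Hermitian Hamiltonian H (with continuous entries), every pair of solutions ρ, σ of the master equation for L_t = −i[H(t), ·] + D whose values at time s are density matrices satisfies ‖ρ(t) − σ(t)‖₁ ≤ e^{−R(D)·(t−s)}·‖ρ(s) − σ(s)‖₁ for all t ≥ s ≥ 0. In particular, D is Hamiltonian-independently contractive with contraction rate at least R(D) and constant K = 1. -/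

import Mathlib

open scoped ComplexOrder Kronecker
open Matrix

namespace Paper

variable {n : Type*} [Fintype n] [DecidableEq n]

/-- Trace norm: sum of singular values. -/
noncomputable def traceNorm (A : Matrix n n ℂ) : ℝ :=
  ∑ i, Real.sqrt ((Matrix.posSemidef_conjTranspose_mul_self A).isHermitian.eigenvalues i)

/-- The dissipator associated with a single jump operator. -/
noncomputable def dissipator (L x : Matrix n n ℂ) : Matrix n n ℂ :=
  L * x * Lᴴ - ((1 : ℂ)/2) • (Lᴴ * L * x + x * (Lᴴ * L))

/-- Total dissipator of a family of jump operators. -/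
noncomputable def totalDissipator {m : ℕ} (L : Fin m → Matrix n n ℂ) (x : Matrix n n ℂ) :
    Matrix n n ℂ :=
  ∑ j, dissipator (L j) x

/-- The Hamiltonian commutator term `-i[H, x]`. -/
noncomputable def hamTerm (H x : Matrix n n ℂ) : Matrix n n ℂ :=
  (-Complex.I) • (H * x - x * H)

/-- A solution of the master equation `ρ' = L_t(ρ)` starting at time `s`
(differentiable entrywise). -/
def IsSolution (Lt : ℝ → Matrix n n ℂ → Matrix n n ℂ) (s : ℝ) (ρ : ℝ → Matrix n n ℂ) : Prop :=
  ∀ t, s ≤ t → ∀ i j, HasDerivAt (fun u => ρ u i j) ((Lt t (ρ t)) i j) t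

/-- Density matrix: Hermitian, positive semidefinite, trace one. -/
def IsDensity (ρ : Matrix n n ℂ) : Prop := ρ.PosSemidef ∧ ρ.trace = 1

/-- Exponential contractivity with constants `K, γ` of a time-dependent Lindbladian. -/
def ExpContractiveWith (Lt : ℝ → Matrix n n ℂ → Matrix n n ℂ) (K γ : ℝ) : Prop :=
  ∀ s t : ℝ, 0 ≤ s → s ≤ t → ∀ ρ σ : ℝ → Matrix n n ℂ,
    IsSolution Lt s ρ → IsSolution Lt s σ → IsDensity (ρ s) → IsDensity (σ s) →
    traceNorm (ρ t - σ t) ≤ K * Real.exp (-γ * (t - s)) * traceNorm (ρ s - σ s)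

/-- Exponential contractivity of a time-dependent Lindbladian. -/
def ExpContractive (Lt : ℝ → Matrix n n ℂ → Matrix n n ℂ) : Prop :=
  ∃ K γ : ℝ, 0 < K ∧ 0 < γ ∧ ExpContractiveWith Lt K γ

/-- Time-dependent Hamiltonian: Hermitian values and continuous entries. -/
def IsHamiltonianFamily (H : ℝ → Matrix n n ℂ) : Prop :=
  (∀ t, (H t).IsHermitian) ∧ ∀ i j, Continuous fun t => H t i j

/-- Driven Lindbladian `x ↦ -i[H(t), x] + D(x)`. -/
noncomputable def driven {m : ℕ} (H : ℝ → Matrix n n ℂ) (L : Fin m → Matrix n n ℂ)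
    (t : ℝ) (x : Matrix n n ℂ) : Matrix n n ℂ :=
  hamTerm (H t) x + totalDissipator L x

/-- Hamiltonian-independent contractivity of a dissipator. -/
def HamIndepContractive {m : ℕ} (L : Fin m → Matrix n n ℂ) : Prop :=
  ∀ H : ℝ → Matrix n n ℂ, IsHamiltonianFamily H → ExpContractive (driven H L)

/-- The operator norm (largest singular value). -/
noncomputable def opNorm (A : Matrix n n ℂ) : ℝ :=
  ‖LinearMap.toContinuousLinearMap (Matrix.toEuclideanLin A)‖

end Paper

namespace Paper

/-- `R(D)`: infimum over orthonormal pairs `u ⊥ v` of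
`Σ_j (|⟨v, L_j u⟩|² + |⟨v, L_j† u⟩|²)`. -/
noncomputable def Rconst {d m : ℕ} (L : Fin m → Matrix (Fin d) (Fin d) ℂ) : ℝ :=
  sInf { r : ℝ | ∃ u v : Fin d → ℂ,
    (∑ i, ‖u i‖ ^ 2) = 1 ∧ (∑ i, ‖v i‖ ^ 2) = 1 ∧ (star u ⬝ᵥ v) = 0 ∧
    r = ∑ j, (‖star v ⬝ᵥ (L j *ᵥ u)‖ ^ 2 + ‖star v ⬝ᵥ ((L j)ᴴ *ᵥ u)‖ ^ 2) }

lemma scalar_key {d : ℕ} (lam s : Fin d → ℝ) (w : Fin d → Fin d → ℝ) (R : ℝ)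
    (h0 : ∑ k, lam k = 0) (hs : ∀ k, s k = if 0 ≤ lam k then 1 else -1)
    (hw : ∀ k l, 0 ≤ w k l) (hR : ∀ k l, k ≠ l → R ≤ w k l + w l k) :
    ∑ k, ∑ l, w k l * (lam l * (s k - s l)) ≤ -R * ∑ k, |lam k| := by
  set p : Fin d → ℝ := fun k => max (lam k) 0 with hp
  set q : Fin d → ℝ := fun k => max (-lam k) 0 with hq
  have hp0 : ∀ k, 0 ≤ p k := fun k => le_max_right _ _
  have hq0 : ∀ k, 0 ≤ q k := fun k => le_max_right _ _
  have hpq : ∀ k, p k - q k = lam k := by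
    intro k; simp only [hp, hq]; rcases le_total 0 (lam k) with h | h
    · rw [max_eq_left h, max_eq_right (by linarith)]; ring
    · rw [max_eq_right h, max_eq_left (by linarith)]; ring
  have hpq' : ∀ k, p k + q k = |lam k| := by
    intro k; simp only [hp, hq]; rcases le_total 0 (lam k) with h | h
    · rw [max_eq_left h, max_eq_right (by linarith), abs_of_nonneg h]; ring
    · rw [max_eq_right h, max_eq_left (by linarith), abs_of_nonpos h]; ring
  have hpqm : ∀ k, p k * q k = 0 := by
    intro k; simp only [hp, hq]; rcases le_total 0 (lam k) with h | h
    · rw [max_eq_right (a := -lam k) (by linarith)]; ring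
    · rw [max_eq_right h]; ring
  set a := ∑ k, p k with ha
  have haq : ∑ k, q k = a := by
    have : ∑ k, (p k - q k) = 0 := by simp_rw [hpq]; exact h0
    rw [Finset.sum_sub_distrib] at this; linarith
  have habs : ∑ k, |lam k| = 2 * a := by
    simp_rw [← hpq']; rw [Finset.sum_add_distrib, haq]; ring
  have hpa : ∀ k, p k ≤ a := fun k => Finset.single_le_sum (fun i _ => hp0 i) (Finset.mem_univ k)
  have hqa : ∀ k, q k ≤ a := fun k => by
    rw [← haq]; exact Finset.single_le_sum (fun i _ => hq0 i) (Finset.mem_univ k)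
  have ha0 : 0 ≤ a := Finset.sum_nonneg fun i _ => hp0 i
  have hpt : ∀ k l, a * (lam l * (s k - s l)) ≤ -2 * (p l * q k + q l * p k) := by
    intro k l
    have h1 := hpq l
    have h2 := hpq k
    rw [hs k, hs l]
    split_ifs with hk hl hl
    · have : q k = 0 := by simp only [hq]; exact max_eq_right (by linarith)
      have : q l = 0 := by simp only [hq]; exact max_eq_right (by linarith)
      simp [*]
    · have e1 : q k = 0 := by simp only [hq]; exact max_eq_right (by linarith)
      have e2 : p l = 0 := by simp only [hp]; exact max_eq_right (by linarith)
      rw [← h1, e1, e2]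
      nlinarith [mul_nonneg (hq0 l) (sub_nonneg.2 (hpa k))]
    · have e1 : p k = 0 := by simp only [hp]; exact max_eq_right (by linarith)
      have e2 : q l = 0 := by simp only [hq]; exact max_eq_right (by linarith)
      rw [← h1, e1, e2]
      nlinarith [mul_nonneg (hp0 l) (sub_nonneg.2 (hqa k))]
    · have e1 : p k = 0 := by simp only [hp]; exact max_eq_right (by linarith)
      have e2 : p l = 0 := by simp only [hp]; exact max_eq_right (by linarith)
      rw [e1, e2]; simp
  rcases ha0.eq_or_lt with h | h
  · have hl : ∀ l, lam l = 0 := by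
      intro l
      have h1 := hpq l
      have := hpa l; have := hqa l; have := hp0 l; have := hq0 l
      linarith
    simp [hl]
  · have main : a * ∑ k, ∑ l, w k l * (lam l * (s k - s l)) ≤ a * (-R * (2 * a)) := by
      calc a * ∑ k, ∑ l, w k l * (lam l * (s k - s l))
          = ∑ k, ∑ l, w k l * (a * (lam l * (s k - s l))) := by
            simp_rw [Finset.mul_sum]
            exact Finset.sum_congr rfl fun k _ => Finset.sum_congr rfl fun l _ => by ring
        _ ≤ ∑ k, ∑ l, w k l * (-2 * (p l * q k + q l * p k)) := by
            exact Finset.sum_le_sum fun k _ => Finset.sum_le_sum fun l _ =>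
              mul_le_mul_of_nonneg_left (hpt k l) (hw k l)
        _ = ∑ k, ∑ l, (-2 * (w k l * (p l * q k))) + ∑ k, ∑ l, (-2 * (w k l * (q l * p k))) := by
            simp_rw [← Finset.sum_add_distrib]
            exact Finset.sum_congr rfl fun k _ => Finset.sum_congr rfl fun l _ => by ring
        _ = ∑ k, ∑ l, (-2 * (w k l * (p l * q k))) + ∑ k, ∑ l, (-2 * (w l k * (q k * p l))) := by
            congr 1; exact Finset.sum_comm
        _ = ∑ k, ∑ l, (-2 * ((w k l + w l k) * (p l * q k))) := by
            simp_rw [← Finset.sum_add_distrib]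
            exact Finset.sum_congr rfl fun k _ => Finset.sum_congr rfl fun l _ => by ring
        _ ≤ ∑ k, ∑ l, (-2 * (R * (p l * q k))) := by
            refine Finset.sum_le_sum fun k _ => Finset.sum_le_sum fun l _ => ?_
            by_cases hkl : k = l
            · subst hkl; rw [hpqm]; simp
            · have := mul_le_mul_of_nonneg_right (hR k l hkl) (mul_nonneg (hp0 l) (hq0 k))
              linarith
        _ = -2 * R * ((∑ k, q k) * ∑ l, p l) := by
            rw [Finset.sum_mul_sum, Finset.mul_sum]
            refine Finset.sum_congr rfl fun k _ => ?_
            rw [Finset.mul_sum]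
            exact Finset.sum_congr rfl fun l _ => by ring
        _ = a * (-R * (2 * a)) := by rw [haq]; ring
    rw [habs]
    exact le_of_mul_le_mul_left main h

lemma spectral' {d : ℕ} {X : Matrix (Fin d) (Fin d) ℂ} (hX : X.IsHermitian) :
    ∃ (U : Matrix (Fin d) (Fin d) ℂ) (lam : Fin d → ℝ), Uᴴ * U = 1 ∧ U * Uᴴ = 1 ∧
      X = U * diagonal (fun k => (lam k : ℂ)) * Uᴴ := by
  refine ⟨hX.eigenvectorUnitary, hX.eigenvalues, ?_, ?_, ?_⟩
  · exact Unitary.coe_star_mul_self _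
  · exact Unitary.coe_mul_star_self _
  · exact hX.spectral_theorem

lemma traceNorm_spectral {d : ℕ} {X U : Matrix (Fin d) (Fin d) ℂ} {lam : Fin d → ℝ}
    (h1 : Uᴴ * U = 1) (hX : X = U * diagonal (fun k => (lam k : ℂ)) * Uᴴ) :
    traceNorm X = ∑ k, |lam k| := by
  have e : Xᴴ * X = U * diagonal (fun k => ((lam k ^ 2 : ℝ) : ℂ)) * Uᴴ := by
    have hd : (diagonal (fun k => (lam k : ℂ)))ᴴ = diagonal (fun k => (lam k : ℂ)) := by
      rw [diagonal_conjTranspose]; congr 1; ext k; simp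
    have : Xᴴ = U * diagonal (fun k => (lam k : ℂ)) * Uᴴ := by
      rw [hX]; simp only [conjTranspose_mul, conjTranspose_conjTranspose, hd, mul_assoc]
    rw [this, hX]
    calc _ = U * diagonal (fun k => (lam k : ℂ)) * (Uᴴ * U) * diagonal (fun k => (lam k : ℂ)) * Uᴴ := by
          simp only [mul_assoc]
      _ = _ := by
          rw [h1, mul_one, mul_assoc U, diagonal_mul_diagonal]
          congr 3; ext k; push_cast; ring
  have hc : (Xᴴ * X).charpoly = ∏ k, (Polynomial.X - Polynomial.C ((lam k ^ 2 : ℝ) : ℂ)) := by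
    rw [e, charpoly_mul_comm, ← mul_assoc, h1, one_mul, charpoly_diagonal]
  have hr := (Matrix.posSemidef_conjTranspose_mul_self X).isHermitian.roots_charpoly_eq_eigenvalues
  rw [hc, Polynomial.roots_prod _ _ (Finset.prod_ne_zero_iff.2 fun k _ => Polynomial.X_sub_C_ne_zero _)] at hr
  have hr2 := congrArg (fun m => (m.map (fun z : ℂ => Real.sqrt z.re)).sum) hr
  simp only [Polynomial.roots_X_sub_C, Multiset.bind_singleton, Multiset.map_map] at hr2
  unfold traceNorm
  simp only [Function.comp_def, Complex.ofReal_re, Real.sqrt_sq_eq_abs] at hr2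
  exact hr2.symm

lemma trace_le_traceNorm {d : ℕ} {S Y : Matrix (Fin d) (Fin d) ℂ} (hY : Y.IsHermitian)
    (hS : S ∈ Matrix.unitaryGroup (Fin d) ℂ) : (S * Y).trace.re ≤ traceNorm Y := by
  obtain ⟨U, lam, h1, h2, h3⟩ := spectral' hY
  rw [traceNorm_spectral h1 h3]
  have hU : U ∈ Matrix.unitaryGroup (Fin d) ℂ := by
    rw [mem_unitaryGroup_iff]; exact h2
  have hU' : Uᴴ ∈ Matrix.unitaryGroup (Fin d) ℂ := by
    rw [mem_unitaryGroup_iff, star_eq_conjTranspose, conjTranspose_conjTranspose]; exact h1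
  have hW : Uᴴ * S * U ∈ Matrix.unitaryGroup (Fin d) ℂ :=
    mul_mem (mul_mem hU' hS) hU
  have : (S * Y).trace = ∑ k, (Uᴴ * S * U) k k * lam k := by
    have : (S * Y).trace = (Uᴴ * S * U * diagonal (fun k => (lam k : ℂ))).trace := by
      rw [h3, ← mul_assoc, trace_mul_comm]; simp only [mul_assoc]
    rw [this]; simp [trace, mul_diagonal]
  rw [this, Complex.re_sum]
  refine Finset.sum_le_sum fun k _ => ?_
  refine (Complex.re_le_norm _).trans ?_
  rw [norm_mul]
  have := entry_norm_bound_of_unitary hW k k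
  calc _ ≤ 1 * ‖(lam k : ℂ)‖ := by gcongr
    _ = |lam k| := by simp

lemma sum_w {d m : ℕ} (L : Fin m → Matrix (Fin d) (Fin d) ℂ) {U : Matrix (Fin d) (Fin d) ℂ}
    (h1 : Uᴴ * U = 1) (k l : Fin d) (hkl : k ≠ l) :
    Rconst L ≤ ∑ j, ‖(Uᴴ * L j * U) k l‖ ^ 2 + ∑ j, ‖(Uᴴ * L j * U) l k‖ ^ 2 := by
  have key : ∀ (A : Matrix (Fin d) (Fin d) ℂ) a b,
      star (fun i => U i a) ⬝ᵥ (A *ᵥ (fun i => U i b)) = (Uᴴ * A * U) a b := by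
    intro A a b
    rw [mul_assoc, mul_apply]
    rfl
  have horth : ∀ a b, star (fun i => U i a) ⬝ᵥ (fun i => U i b) = (1 : Matrix (Fin d) (Fin d) ℂ) a b := by
    intro a b
    rw [← h1, mul_apply]; rfl
  have hn : ∀ a, ∑ i, ‖U i a‖ ^ 2 = 1 := by
    intro a
    have := horth a a
    simp only [dotProduct, Pi.star_apply, RCLike.star_def, Complex.conj_mul', one_apply_eq] at this
    exact_mod_cast this
  refine csInf_le ⟨0, ?_⟩ ⟨fun i => U i l, fun i => U i k, hn l, hn k, ?_, ?_⟩
  · rintro r ⟨u, v, -, -, -, rfl⟩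
    positivity
  · rw [horth]; exact one_apply_ne hkl.symm
  · rw [← Finset.sum_add_distrib]
    refine Finset.sum_congr rfl fun j _ => ?_
    rw [key, key]
    congr 2
    have : Uᴴ * (L j)ᴴ * U = (Uᴴ * L j * U)ᴴ := by
      simp [conjTranspose_mul, mul_assoc]
    rw [this, conjTranspose_apply, norm_star]

lemma trace_ham {d : ℕ} (H X S : Matrix (Fin d) (Fin d) ℂ) (h : X * S = S * X) :
    (S * hamTerm H X).trace = 0 := by
  unfold hamTerm
  rw [mul_smul_comm, trace_smul, mul_sub, trace_sub]
  have : (S * (H * X)).trace = (S * (X * H)).trace := by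
    rw [trace_mul_comm, mul_assoc, h, trace_mul_comm, mul_assoc]
  rw [this]; simp

lemma trace_diss {d : ℕ} (L X S U : Matrix (Fin d) (Fin d) ℂ) (lam s : Fin d → ℝ)
    (h1 : Uᴴ * U = 1) (h2 : U * Uᴴ = 1)
    (hX : X = U * diagonal (fun k => (lam k : ℂ)) * Uᴴ)
    (hS : S = U * diagonal (fun k => (s k : ℂ)) * Uᴴ) :
    (S * dissipator L X).trace.re =
      ∑ k, ∑ l, ‖(Uᴴ * L * U) k l‖ ^ 2 * (lam l * (s k - s l)) := by
  set M := Uᴴ * L * U with hM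
  set dl := diagonal (fun k => (lam k : ℂ)) with hdl
  set ds := diagonal (fun k => (s k : ℂ)) with hds
  have hL : L = U * M * Uᴴ := by
    rw [hM]
    calc L = (U * Uᴴ) * L * (U * Uᴴ) := by rw [h2]; simp
      _ = _ := by simp only [mul_assoc]
  have hL' : Lᴴ = U * Mᴴ * Uᴴ := by
    conv_lhs => rw [hL]
    simp [conjTranspose_mul, mul_assoc]
  have c : ∀ Z : Matrix (Fin d) (Fin d) ℂ, Uᴴ * (U * Z) = Z := fun Z => by
    rw [← mul_assoc, h1, one_mul]
  have t : ∀ Z : Matrix (Fin d) (Fin d) ℂ, (U * (Z * Uᴴ)).trace = Z.trace := fun Z => by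
    rw [trace_mul_comm, mul_assoc, h1, mul_one]
  have e : S * dissipator L X = U * (ds * M * dl * Mᴴ - ((1 : ℂ)/2) •
      (ds * Mᴴ * M * dl + ds * dl * Mᴴ * M)) * Uᴴ := by
    unfold dissipator
    rw [hL', hS, hX]
    conv_lhs => rw [hL]
    simp only [mul_assoc, c, mul_sub, sub_mul, mul_add, add_mul, mul_smul_comm, smul_mul_assoc]
  rw [e, mul_assoc, t, trace_sub, trace_smul, trace_add]
  have t1 : (ds * M * dl * Mᴴ).trace = ((∑ k, ∑ l, ‖M k l‖ ^ 2 * (lam l * s k) : ℝ) : ℂ) := by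
    simp only [trace, diag_apply]
    push_cast
    simp only [mul_apply (N := Mᴴ), conjTranspose_apply, hdl, hds, mul_diagonal, diagonal_mul]
    refine Finset.sum_congr rfl fun k _ => Finset.sum_congr rfl fun l _ => ?_
    rw [← Complex.mul_conj']
    simp only [RCLike.star_def]; ring
  have t2 : (ds * Mᴴ * M * dl).trace = ((∑ k, ∑ l, ‖M k l‖ ^ 2 * (lam l * s l) : ℝ) : ℂ) := by
    rw [Finset.sum_comm]
    simp only [trace, diag_apply, conjTranspose_apply, hdl, hds,
      mul_diagonal, mul_apply (M := diagonal _ * Mᴴ), diagonal_mul]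
    push_cast
    refine Finset.sum_congr rfl fun k _ => ?_
    rw [Finset.sum_mul]
    refine Finset.sum_congr rfl fun l _ => ?_
    rw [← Complex.mul_conj']
    simp only [RCLike.star_def]; ring
  have t3 : (ds * dl * Mᴴ * M).trace = (ds * Mᴴ * M * dl).trace := by
    rw [trace_mul_comm (ds * Mᴴ * M) dl]
    have : ds * dl = dl * ds := by simp [hds, hdl, mul_comm]
    rw [this]; simp only [mul_assoc]
  rw [t3, t1, t2]
  rw [← Complex.ofReal_add, smul_eq_mul]
  have : ((1:ℂ)/2) = ((1/2 : ℝ) : ℂ) := by push_cast; rfl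
  rw [this, ← Complex.ofReal_mul, ← Complex.ofReal_sub, Complex.ofReal_re]
  simp_rw [mul_sub, Finset.sum_sub_distrib]
  ring

lemma exists_sign {d m : ℕ} (L : Fin m → Matrix (Fin d) (Fin d) ℂ)
    {X : Matrix (Fin d) (Fin d) ℂ} (hX : X.IsHermitian) (h0 : X.trace = 0) :
    ∃ S ∈ Matrix.unitaryGroup (Fin d) ℂ, (S * X).trace.re = traceNorm X ∧
      ∀ H, (S * (hamTerm H X + totalDissipator L X)).trace.re ≤ -Rconst L * traceNorm X := by
  obtain ⟨U, lam, h1, h2, h3⟩ := spectral' hX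
  set s : Fin d → ℝ := fun k => if 0 ≤ lam k then 1 else -1 with hs
  have hss : ∀ k, s k * s k = 1 := by intro k; simp only [hs]; split_ifs <;> norm_num
  have hls : ∀ k, s k * lam k = |lam k| := by
    intro k; simp only [hs]; split_ifs with h
    · rw [abs_of_nonneg h, one_mul]
    · rw [abs_of_neg (not_le.1 h)]; ring
  set S := U * diagonal (fun k => (s k : ℂ)) * Uᴴ with hS
  have c : ∀ Z : Matrix (Fin d) (Fin d) ℂ, Uᴴ * (U * Z) = Z := fun Z => by
    rw [← mul_assoc, h1, one_mul]
  have t : ∀ Z : Matrix (Fin d) (Fin d) ℂ, (U * (Z * Uᴴ)).trace = Z.trace := fun Z => by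
    rw [trace_mul_comm, mul_assoc, h1, mul_one]
  have hSX : S * X = U * (diagonal (fun k => (s k : ℂ) * lam k) * Uᴴ) := by
    rw [hS, h3, ← diagonal_mul_diagonal]; simp only [mul_assoc, c]
  have hXS : X * S = S * X := by
    rw [hSX, hS, h3]
    simp only [mul_assoc, c]
    rw [← mul_assoc (diagonal _), diagonal_mul_diagonal]
    simp only [mul_comm]
  have hl0 : ∑ k, lam k = 0 := by
    rw [h3, mul_assoc, t, trace_diagonal] at h0
    exact_mod_cast h0
  refine ⟨S, ?_, ?_, ?_⟩
  · rw [mem_unitaryGroup_iff, star_eq_conjTranspose, hS]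
    have hd : (diagonal (fun k => (s k : ℂ)))ᴴ = diagonal (fun k => (s k : ℂ)) := by
      rw [diagonal_conjTranspose]; congr 1; ext k; simp
    simp only [conjTranspose_mul, conjTranspose_conjTranspose, hd, mul_assoc, c]
    rw [← mul_assoc (diagonal _), diagonal_mul_diagonal]
    have : (fun i => (s i : ℂ) * (s i : ℂ)) = fun _ => 1 := by
      ext k; rw [← Complex.ofReal_mul, hss]; simp
    rw [this, diagonal_one, one_mul, h2]
  · rw [hSX, t, trace_diagonal, traceNorm_spectral h1 h3, Complex.re_sum]
    refine Finset.sum_congr rfl fun k _ => ?_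
    rw [← Complex.ofReal_mul, Complex.ofReal_re, hls]
  · intro H
    rw [mul_add, trace_add, trace_ham H X S hXS, zero_add, totalDissipator, Finset.mul_sum,
      trace_sum, Complex.re_sum, traceNorm_spectral h1 h3]
    simp_rw [trace_diss _ X S U lam s h1 h2 h3 hS]
    have := scalar_key lam s (fun k l => ∑ j, ‖(Uᴴ * L j * U) k l‖ ^ 2) (Rconst L) hl0
      (fun k => rfl) (fun k l => by positivity) (fun k l hkl => sum_w L h1 k l hkl)
    refine le_trans (le_of_eq ?_) this
    rw [Finset.sum_comm]
    refine Finset.sum_congr rfl fun k _ => ?_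
    rw [Finset.sum_comm]
    refine Finset.sum_congr rfl fun l _ => ?_
    rw [Finset.sum_mul]

lemma traceNorm_sub_le {d : ℕ} {X Y : Matrix (Fin d) (Fin d) ℂ} (hX : X.IsHermitian)
    (hY : Y.IsHermitian) (h0 : X.trace = 0) :
    traceNorm X - traceNorm Y ≤ ∑ i, ∑ j, ‖X i j - Y i j‖ := by
  obtain ⟨S, hS, h1, -⟩ := exists_sign (m := 0) (fun _ => 0) hX h0
  have h2 := trace_le_traceNorm hY hS
  rw [← h1]
  calc (S * X).trace.re - traceNorm Y ≤ (S * X).trace.re - (S * Y).trace.re := by linarith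
    _ = ((X - Y) * S).trace.re := by
      rw [← Complex.sub_re, ← trace_sub, ← mul_sub, trace_mul_comm]
    _ ≤ ‖((X - Y) * S).trace‖ := Complex.re_le_norm _
    _ ≤ ∑ i, ∑ j, ‖X i j - Y i j‖ := by
      simp only [trace, diag_apply, mul_apply, Matrix.sub_apply]
      refine (norm_sum_le _ _).trans (Finset.sum_le_sum fun i _ => ?_)
      refine (norm_sum_le _ _).trans (Finset.sum_le_sum fun j _ => ?_)
      rw [norm_mul]
      exact mul_le_of_le_one_right (norm_nonneg _) (entry_norm_bound_of_unitary hS j i)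

lemma traceNorm_eq_zero {d : ℕ} {X : Matrix (Fin d) (Fin d) ℂ} (hX : X.IsHermitian)
    (h : traceNorm X ≤ 0) : X = 0 := by
  obtain ⟨U, lam, h1, h2, h3⟩ := spectral' hX
  rw [traceNorm_spectral h1 h3] at h
  have h' : ∑ k, |lam k| = 0 := le_antisymm h (Finset.sum_nonneg fun _ _ => abs_nonneg _)
  rw [Finset.sum_eq_zero_iff_of_nonneg (fun _ _ => abs_nonneg _)] at h'
  have : ∀ k, lam k = 0 := fun k => abs_eq_zero.1 (h' k (Finset.mem_univ k))
  rw [h3]; simp [this]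

lemma traceNorm_zero {d : ℕ} : traceNorm (0 : Matrix (Fin d) (Fin d) ℂ) = 0 := by
  rw [traceNorm_spectral (X := 0) (U := 1) (lam := fun _ => 0) (by simp) (by simp)]
  simp

open Filter Topology in
lemma contract {d m : ℕ} (L : Fin m → Matrix (Fin d) (Fin d) ℂ)
    (H : ℝ → Matrix (Fin d) (Fin d) ℂ) (s t : ℝ) (hst : s ≤ t) (Z : ℝ → Matrix (Fin d) (Fin d) ℂ)
    (hH : ∀ u, s ≤ u → (Z u).IsHermitian) (h0 : ∀ u, s ≤ u → (Z u).trace = 0)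
    (hZ : IsSolution (driven H L) s Z) :
    traceNorm (Z t) ≤ Real.exp (-(Rconst L) * (t - s)) * traceNorm (Z s) := by
  set R := Rconst L with hR
  have hcont : ContinuousOn (fun u => traceNorm (Z u)) (Set.Ici s) := by
    intro u hu
    have hb : Tendsto (fun v => ∑ i, ∑ j, ‖Z v i j - Z u i j‖) (𝓝[Set.Ici s] u) (𝓝 0) := by
      have : Tendsto (fun v => ∑ i, ∑ j, ‖Z v i j - Z u i j‖) (𝓝[Set.Ici s] u)
          (𝓝 (∑ i, ∑ j, ‖Z u i j - Z u i j‖)) := by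
        refine tendsto_finsetSum _ fun i _ => tendsto_finsetSum _ fun j _ => ?_
        have := (hZ u hu i j).continuousAt.tendsto.mono_left
          (nhdsWithin_le_nhds : 𝓝[Set.Ici s] u ≤ 𝓝 u)
        exact (this.sub_const _).norm
      simpa using this
    unfold ContinuousWithinAt
    rw [tendsto_iff_dist_tendsto_zero]
    refine squeeze_zero' (Eventually.of_forall fun _ => dist_nonneg) ?_ hb
    filter_upwards [self_mem_nhdsWithin] with v hv
    rw [Real.dist_eq, abs_le]
    constructor
    · have := traceNorm_sub_le (hH u hu) (hH v hv) (h0 u hu)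
      simp_rw [norm_sub_rev (Z u _ _)] at this
      linarith
    · exact traceNorm_sub_le (hH v hv) (hH u hu) (h0 v hv)
  set φ : ℝ → ℝ := fun u => -(Real.exp (-R * u) * traceNorm (Z (t - u))) with hφ
  have hφc : ContinuousOn φ (Set.Icc 0 (t - s)) := by
    refine (ContinuousOn.mul (by fun_prop) ?_).neg
    refine hcont.comp (by fun_prop) ?_
    intro u hu
    simp only [Set.mem_Ici]; linarith [hu.2]
  have main := image_le_of_liminf_slope_right_le_deriv_boundary hφc (B := fun _ => φ 0)
    (B' := fun _ => 0) le_rfl continuousOn_const (fun x _ => hasDerivWithinAt_const _ _ _) ?_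
    (Set.right_mem_Icc.2 (sub_nonneg.2 hst))
  · simp only [hφ] at main
    rw [show t - (t - s) = s by ring, sub_zero, mul_zero, Real.exp_zero, one_mul] at main
    linarith
  intro x hx r hr
  have hxs : s ≤ t - x := by linarith [hx.2]
  obtain ⟨S, hS, h1, h2⟩ := exists_sign L (hH _ hxs) (h0 _ hxs)
  have h2 := h2 (H (t - x))
  set g : ℝ → ℝ := fun u => -(Real.exp (-R * u) * (S * Z (t - u)).trace.re) with hg
  have hd1 : HasDerivAt (fun u => (S * Z u).trace)
      (S * driven H L (t - x) (Z (t - x))).trace (t - x) := by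
    simp only [trace, diag_apply, mul_apply]
    refine HasDerivAt.fun_sum fun i _ => HasDerivAt.fun_sum fun j _ => ?_
    exact (hZ _ hxs j i).const_mul _
  have hd2 : HasDerivAt (fun u => (S * Z u).trace.re)
      (S * driven H L (t - x) (Z (t - x))).trace.re (t - x) :=
    Complex.reCLM.hasFDerivAt.comp_hasDerivAt _ hd1
  have hd3 : HasDerivAt (fun u => (S * Z (t - u)).trace.re)
      (-(S * driven H L (t - x) (Z (t - x))).trace.re) x := by
    have := HasDerivAt.comp x hd2 ((hasDerivAt_id x).const_sub t)
    rw [mul_neg_one] at this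
    exact this
  have hd4 : HasDerivAt (fun u => Real.exp (-R * u)) (Real.exp (-R * x) * (-R)) x := by
    have := ((hasDerivAt_id x).const_mul (-R)).exp
    simpa using this
  have hd5 := (hd4.mul hd3).neg
  have hle : -(Real.exp (-R * x) * (-R) * (S * Z (t - x)).trace.re + Real.exp (-R * x) *
      (-(S * driven H L (t - x) (Z (t - x))).trace.re)) ≤ 0 := by
    rw [h1]
    have : (S * driven H L (t - x) (Z (t - x))).trace.re ≤ -R * traceNorm (Z (t - x)) := h2
    have := mul_le_mul_of_nonneg_left this (Real.exp_pos (-R * x)).le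
    nlinarith
  have hd6 := hasDerivAt_iff_tendsto_slope.1 hd5
  have hd7 := hd6.mono_left (nhdsWithin_mono x (fun y (hy : x < y) => ne_of_gt hy) : 𝓝[>] x ≤ 𝓝[≠] x)
  have hev := hd7.eventually_lt_const (lt_of_le_of_lt hle hr)
  have hev2 : ∀ᶠ z in 𝓝[>] x, z < t - s :=
    nhdsWithin_le_nhds (eventually_lt_nhds hx.2)
  refine Eventually.frequently ?_
  filter_upwards [hev, hev2, self_mem_nhdsWithin] with z hz hz2 hz3
  refine lt_of_le_of_lt ?_ hz
  have hz3 : x < z := hz3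
  have hzs : s ≤ t - z := by linarith
  have h4 := trace_le_traceNorm (hH _ hzs) hS
  have h5 := mul_le_mul_of_nonneg_left h4 (Real.exp_pos (-R * z)).le
  simp only [slope_def_field]
  refine div_le_div_of_nonneg_right ?_ (by linarith)
  simp only [hφ, Pi.neg_apply, Pi.mul_apply, h1]
  linarith

lemma driven_conj {d m : ℕ} (L : Fin m → Matrix (Fin d) (Fin d) ℂ)
    (H : ℝ → Matrix (Fin d) (Fin d) ℂ) (t : ℝ) (hH : (H t).IsHermitian)
    (x : Matrix (Fin d) (Fin d) ℂ) : (driven H L t x)ᴴ = driven H L t xᴴ := by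
  have hH' : (H t)ᴴ = H t := hH
  unfold driven hamTerm totalDissipator dissipator
  simp only [conjTranspose_add, conjTranspose_smul, conjTranspose_sub, conjTranspose_mul, hH',
    conjTranspose_sum, conjTranspose_conjTranspose]
  congr 1
  · simp only [RCLike.star_def, map_neg, Complex.conj_I, neg_smul, smul_sub]
    simp only [neg_neg]; abel
  · refine Finset.sum_congr rfl fun j _ => ?_
    simp only [mul_assoc]
    congr 1
    rw [add_comm]
    congr 1
    simp

lemma driven_sub {d m : ℕ} (L : Fin m → Matrix (Fin d) (Fin d) ℂ)
    (H : ℝ → Matrix (Fin d) (Fin d) ℂ) (t : ℝ)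
    (x y : Matrix (Fin d) (Fin d) ℂ) :
    driven H L t (x - y) = driven H L t x - driven H L t y := by
  unfold driven hamTerm totalDissipator dissipator
  rw [add_sub_add_comm, ← Finset.sum_sub_distrib, ← smul_sub]
  congr 1
  · congr 1; noncomm_ring
  · refine Finset.sum_congr rfl fun j _ => ?_
    rw [sub_sub_sub_comm, ← smul_sub]
    congr 1
    · noncomm_ring
    · congr 1; noncomm_ring

lemma driven_smul {d m : ℕ} (L : Fin m → Matrix (Fin d) (Fin d) ℂ)
    (H : ℝ → Matrix (Fin d) (Fin d) ℂ) (t : ℝ) (c : ℂ)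
    (x : Matrix (Fin d) (Fin d) ℂ) :
    driven H L t (c • x) = c • driven H L t x := by
  unfold driven hamTerm totalDissipator dissipator
  simp only [smul_add, Finset.smul_sum, smul_sub, mul_smul_comm, smul_mul_assoc, smul_comm c]

lemma driven_trace {d m : ℕ} (L : Fin m → Matrix (Fin d) (Fin d) ℂ)
    (H : ℝ → Matrix (Fin d) (Fin d) ℂ) (t : ℝ)
    (x : Matrix (Fin d) (Fin d) ℂ) : (driven H L t x).trace = 0 := by
  unfold driven hamTerm totalDissipator dissipator
  simp only [trace_add, trace_smul, trace_sub, trace_sum]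
  rw [trace_mul_comm (H t) x, sub_self, smul_zero, zero_add]
  refine Finset.sum_eq_zero fun j _ => ?_
  rw [trace_mul_comm x, trace_mul_comm (L j * x), ← mul_assoc, smul_eq_mul]
  ring

lemma trace_const {d m : ℕ} (L : Fin m → Matrix (Fin d) (Fin d) ℂ)
    (H : ℝ → Matrix (Fin d) (Fin d) ℂ) (s : ℝ) (Z : ℝ → Matrix (Fin d) (Fin d) ℂ)
    (hZ : IsSolution (driven H L) s Z) (u : ℝ) (hu : s ≤ u) : (Z u).trace = (Z s).trace := by
  have hd : ∀ v, s ≤ v → HasDerivAt (fun u => (Z u).trace) 0 v := by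
    intro v hv
    rw [← driven_trace L H v (Z v)]
    simp only [trace, diag_apply]
    exact HasDerivAt.fun_sum fun i _ => hZ v hv i i
  exact constant_of_has_deriv_right_zero (f := fun u => (Z u).trace) (a := s) (b := u)
    (fun v hv => (hd v hv.1).continuousAt.continuousWithinAt)
    (fun v hv => (hd v hv.1).hasDerivWithinAt) u ⟨hu, le_rfl⟩

lemma sub_solution {d m : ℕ} {L : Fin m → Matrix (Fin d) (Fin d) ℂ}
    {H : ℝ → Matrix (Fin d) (Fin d) ℂ} {s : ℝ} {Z W : ℝ → Matrix (Fin d) (Fin d) ℂ}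
    (hZ : IsSolution (driven H L) s Z) (hW : IsSolution (driven H L) s W) :
    IsSolution (driven H L) s (fun u => Z u - W u) := by
  intro t ht i j
  simp only [driven_sub, Matrix.sub_apply]
  exact (hZ t ht i j).sub (hW t ht i j)

lemma hermitian_solution {d m : ℕ} (L : Fin m → Matrix (Fin d) (Fin d) ℂ)
    (H : ℝ → Matrix (Fin d) (Fin d) ℂ) (hH : ∀ t, (H t).IsHermitian)
    (s : ℝ) (Z : ℝ → Matrix (Fin d) (Fin d) ℂ)
    (hZ : IsSolution (driven H L) s Z) (h0 : (Z s).IsHermitian) (u : ℝ) (hu : s ≤ u) :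
    (Z u).IsHermitian := by
  have hC : IsSolution (driven H L) s (fun u => (Z u)ᴴ) := by
    intro t ht i j
    simp only [← driven_conj L H t (hH t), conjTranspose_apply]
    exact (hZ t ht j i).star
  have hY := sub_solution hZ hC
  set Y : ℝ → Matrix (Fin d) (Fin d) ℂ := fun u => Complex.I • (Z u - (Z u)ᴴ) with hYdef
  have hYs : IsSolution (driven H L) s Y := by
    intro t ht i j
    simp only [hYdef, driven_smul, Matrix.smul_apply, smul_eq_mul]
    exact (hY t ht i j).const_mul _
  have hs0 : Y s = 0 := by
    have : (Z s)ᴴ = Z s := h0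
    simp [hYdef, this]
  have hYh : ∀ u, (Y u).IsHermitian := by
    intro u
    simp only [IsHermitian, hYdef, conjTranspose_smul, conjTranspose_sub,
      conjTranspose_conjTranspose, RCLike.star_def, Complex.conj_I, neg_smul, smul_sub]
    abel
  have := contract L H s u hu Y (fun v _ => hYh v)
    (fun v hv => by rw [trace_const L H s Y hYs v hv, hs0, trace_zero]) hYs
  rw [hs0, traceNorm_zero, mul_zero] at this
  have h := traceNorm_eq_zero (hYh u) this
  simp only [hYdef, smul_eq_zero, Complex.I_ne_zero, false_or] at h
  exact (sub_eq_zero.1 h).symm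

/-- if `R(D) > 0` then the dissipator is Hamiltonian-independently
contractive, with contraction rate at least `R(D)` and constant `K = 1`. -/
theorem R_pos_contractive {d m : ℕ} (L : Fin m → Matrix (Fin d) (Fin d) ℂ)
    (hR : 0 < Rconst L) :
    (∀ H : ℝ → Matrix (Fin d) (Fin d) ℂ, IsHamiltonianFamily H →
      ∀ s t : ℝ, 0 ≤ s → s ≤ t → ∀ ρ σ : ℝ → Matrix (Fin d) (Fin d) ℂ,
        IsSolution (driven H L) s ρ → IsSolution (driven H L) s σ →
        IsDensity (ρ s) → IsDensity (σ s) →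
        traceNorm (ρ t - σ t) ≤
          Real.exp (-(Rconst L) * (t - s)) * traceNorm (ρ s - σ s)) ∧
    HamIndepContractive L := by
  have main : ∀ H : ℝ → Matrix (Fin d) (Fin d) ℂ, IsHamiltonianFamily H →
      ∀ s t : ℝ, 0 ≤ s → s ≤ t → ∀ ρ σ : ℝ → Matrix (Fin d) (Fin d) ℂ,
        IsSolution (driven H L) s ρ → IsSolution (driven H L) s σ →
        IsDensity (ρ s) → IsDensity (σ s) →
        traceNorm (ρ t - σ t) ≤
          Real.exp (-(Rconst L) * (t - s)) * traceNorm (ρ s - σ s) := by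
    intro H hH s t _ hst ρ σ hρ hσ dρ dσ
    have hX := sub_solution hρ hσ
    refine contract L H s t hst (fun u => ρ u - σ u) ?_ ?_ hX
    · exact hermitian_solution L H hH.1 s _ hX (dρ.1.isHermitian.sub dσ.1.isHermitian)
    · intro u hu
      rw [trace_const L H s _ hX u hu, trace_sub, dρ.2, dσ.2, sub_self]
  refine ⟨main, fun H hH => ⟨1, Rconst L, one_pos, hR, ?_⟩⟩
  intro s t hs hst ρ σ hρ hσ dρ dσ
  rw [one_mul]
  exact main H hH s t hs hst ρ σ hρ hσ dρ dσ


end Paper
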